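/- Let Φ be an m×N complex matrix with restricted isometry constant δ_{4s}(Φ) ≤ 0.1, let x ∈ ℂ^N and e ∈ ℂ^m be arbitrary, let u = Φx + e, and let (a^k) be the sequence of approximations produced by CoSaMP with sparsity level s. Then for every k ≥ 0, a^k is s-sparse and ‖x − a^{k+1}‖₂ ≤ 0.5·‖x − a^k‖₂ + 10·ν, where ν = ‖x − x_s‖₂ + s^{−1/2}·‖x − x_s‖₁ + ‖e‖₂ is the unrecoverable energy. -/

import Mathlib

open Matrix
open scoped BigOperators Classical

/-- The Euclidean (ℓ₂) norm of a finitely indexed complex vector. -/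
noncomputable def l2 {ι : Type*} [Fintype ι] (x : ι → ℂ) : ℝ :=
  Real.sqrt (∑ i, ‖x i‖ ^ 2)

/-- The ℓ₁ norm of a finitely indexed complex vector. -/
noncomputable def l1 {ι : Type*} [Fintype ι] (x : ι → ℂ) : ℝ := ∑ i, ‖x i‖

/-- The ℓ∞ (supremum) norm of a finitely indexed complex vector. -/
noncomputable def linf {ι : Type*} [Fintype ι] (x : ι → ℂ) : ℝ := ⨆ i, ‖x i‖

/-- The support of a vector, as a finite set of coordinates. -/
noncomputable def suppF {N : ℕ} (x : Fin N → ℂ) : Finset (Fin N) :=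
  Finset.univ.filter fun i => x i ≠ 0

/-- A vector is `s`-sparse when it has at most `s` nonzero entries. -/
def Sparse {N : ℕ} (s : ℕ) (x : Fin N → ℂ) : Prop := (suppF x).card ≤ s

/-- Restriction of a vector to a set `T` of coordinates: equal to `x` on `T`, zero off `T`. -/
noncomputable def restrictTo {N : ℕ} (x : Fin N → ℂ) (T : Finset (Fin N)) : Fin N → ℂ :=
  fun i => if i ∈ T then x i else 0

/-- `y` is a best `s`-sparse approximation of `x`: it agrees with `x` on a set of `s`
coordinates of largest magnitude and vanishes elsewhere. -/
def IsSparseApprox {N : ℕ} (s : ℕ) (x y : Fin N → ℂ) : Prop :=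
  ∃ T : Finset (Fin N), T.card = min s N ∧ y = restrictTo x T ∧
    ∀ i ∈ T, ∀ j ∉ T, ‖x j‖ ≤ ‖x i‖

/-- The `r`-th restricted isometry constant of `Φ`: the least `δ ≥ 0` such that
`(1-δ)‖x‖² ≤ ‖Φx‖² ≤ (1+δ)‖x‖²` for all `r`-sparse `x`. -/
noncomputable def RIC {m N : ℕ} (Φ : Matrix (Fin m) (Fin N) ℂ) (r : ℕ) : ℝ :=
  sInf {δ : ℝ | 0 ≤ δ ∧ ∀ x : Fin N → ℂ, Sparse r x →
    (1 - δ) * l2 x ^ 2 ≤ l2 (Φ.mulVec x) ^ 2 ∧ l2 (Φ.mulVec x) ^ 2 ≤ (1 + δ) * l2 x ^ 2}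

/-- The column submatrix of `Φ` with columns indexed by the finite set `T`. -/
noncomputable def colSub {m N : ℕ} (Φ : Matrix (Fin m) (Fin N) ℂ) (T : Finset (Fin N)) :
    Matrix (Fin m) {i // i ∈ T} ℂ :=
  Matrix.of fun r c => Φ r c.1

/-- The least-squares estimate `Φ_T† u = (Φ_T* Φ_T)⁻¹ Φ_T* u`, viewed as a vector in `ℂ^N`
supported on `T`. -/
noncomputable def pinvApply {m N : ℕ} (Φ : Matrix (Fin m) (Fin N) ℂ) (T : Finset (Fin N))
    (u : Fin m → ℂ) : Fin N → ℂ :=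
  fun j =>
    if h : j ∈ T then (((colSub Φ T)ᴴ * colSub Φ T)⁻¹ * (colSub Φ T)ᴴ).mulVec u ⟨j, h⟩
    else 0

/-- One iteration of CoSaMP with samples `u` and sparsity level `s`, mapping the current
approximation `a` to the next approximation `a'`. -/
def CoSaMPStep {m N : ℕ} (Φ : Matrix (Fin m) (Fin N) ℂ) (u : Fin m → ℂ) (s : ℕ)
    (a a' : Fin N → ℂ) : Prop :=
  ∃ y2s : Fin N → ℂ,
    IsSparseApprox (2 * s) (Φᴴ.mulVec (u - Φ.mulVec a)) y2s ∧
    IsSparseApprox s (pinvApply Φ (suppF y2s ∪ suppF a) u) a'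

/-- `a` is a sequence of approximations produced by CoSaMP: `a 0 = 0` and each successive
approximation arises from one CoSaMP iteration. -/
def CoSaMPSeq {m N : ℕ} (Φ : Matrix (Fin m) (Fin N) ℂ) (u : Fin m → ℂ) (s : ℕ)
    (a : ℕ → Fin N → ℂ) : Prop :=
  a 0 = 0 ∧ ∀ k, CoSaMPStep Φ u s (a k) (a (k + 1))

/-- The spectral norm (ℓ₂ → ℓ₂ operator norm) of a matrix. -/
noncomputable def specNorm {a b : Type*} [Fintype a] [Fintype b] (M : Matrix a b ℂ) : ℝ :=
  sSup ((fun x => l2 (M.mulVec x)) '' {x | l2 x ≤ 1})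

/-- The real part of the standard inner product of two complex vectors. -/
noncomputable def reInner {ι : Type*} [Fintype ι] (x y : ι → ℂ) : ℝ := (star x ⬝ᵥ y).re

section Norms

variable {ι : Type*} [Fintype ι]

lemma l2_eq_norm (x : ι → ℂ) : l2 x = ‖(WithLp.toLp 2 x : EuclideanSpace ℂ ι)‖ := by
  rw [EuclideanSpace.norm_eq]; rfl

lemma l2_nonneg (x : ι → ℂ) : 0 ≤ l2 x := Real.sqrt_nonneg _

lemma l2_sq (x : ι → ℂ) : l2 x ^ 2 = ∑ i, ‖x i‖ ^ 2 :=
  Real.sq_sqrt (Finset.sum_nonneg fun _ _ => sq_nonneg _)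

lemma l2_add_le (x y : ι → ℂ) : l2 (x + y) ≤ l2 x + l2 y := by
  simp only [l2_eq_norm, WithLp.toLp_add]; exact norm_add_le _ _

lemma l2_sub_le (x y : ι → ℂ) : l2 (x - y) ≤ l2 x + l2 y := by
  simp only [l2_eq_norm, WithLp.toLp_sub]; exact norm_sub_le _ _

lemma l2_sub_comm (x y : ι → ℂ) : l2 (x - y) = l2 (y - x) := by
  simp only [l2_eq_norm, WithLp.toLp_sub]; exact norm_sub_rev _ _

lemma l2_zero : l2 (0 : ι → ℂ) = 0 := by simp [l2]

lemma eq_zero_of_l2_eq_zero {x : ι → ℂ} (h : l2 x = 0) : x = 0 := by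
  rw [l2_eq_norm, norm_eq_zero] at h
  simpa using h

lemma reInner_eq_inner (x y : ι → ℂ) :
    reInner x y = (inner ℂ (WithLp.toLp 2 x : EuclideanSpace ℂ ι) (WithLp.toLp 2 y)).re := by
  rw [EuclideanSpace.inner_toLp_toLp, dotProduct_comm]; rfl

lemma reInner_le (x y : ι → ℂ) : reInner x y ≤ l2 x * l2 y := by
  rw [reInner_eq_inner, l2_eq_norm, l2_eq_norm]
  exact re_inner_le_norm (𝕜 := ℂ) _ _

lemma reInner_self (x : ι → ℂ) : reInner x x = l2 x ^ 2 := by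
  rw [reInner_eq_inner, l2_eq_norm]
  exact inner_self_eq_norm_sq (𝕜 := ℂ) _

lemma reInner_add_right (x y z : ι → ℂ) : reInner x (y + z) = reInner x y + reInner x z := by
  simp [reInner, dotProduct_add]

lemma reInner_sub_right (x y z : ι → ℂ) : reInner x (y - z) = reInner x y - reInner x z := by
  simp [reInner, dotProduct_sub]

lemma reInner_neg_right (x y : ι → ℂ) : reInner x (-y) = -reInner x y := by
  simp [reInner]

lemma l2_neg (x : ι → ℂ) : l2 (-x) = l2 x := by
  simp [l2]

lemma reInner_smul_smul (c d : ℝ) (x y : ι → ℂ) :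
    reInner (c • x) (d • y) = c * d * reInner x y := by
  simp only [reInner, star_smul, smul_dotProduct, dotProduct_smul, Complex.smul_re, smul_eq_mul,
    star_trivial]
  ring

lemma l2_smul (c : ℝ) (x : ι → ℂ) : l2 (c • x) = |c| * l2 x := by
  simp only [l2_eq_norm, WithLp.toLp_smul, norm_smul, Real.norm_eq_abs]

lemma l2_add_sq (x y : ι → ℂ) : l2 (x + y) ^ 2 = l2 x ^ 2 + 2 * reInner x y + l2 y ^ 2 := by
  simp only [l2_eq_norm, reInner_eq_inner, WithLp.toLp_add]
  exact norm_add_sq (𝕜 := ℂ) _ _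

lemma l2_sub_sq (x y : ι → ℂ) : l2 (x - y) ^ 2 = l2 x ^ 2 - 2 * reInner x y + l2 y ^ 2 := by
  simp only [l2_eq_norm, reInner_eq_inner, WithLp.toLp_sub]
  exact norm_sub_sq (𝕜 := ℂ) _ _

lemma reInner_mulVec {κ : Type*} [Fintype κ] (M : Matrix κ ι ℂ) (v : ι → ℂ) (w : κ → ℂ) :
    reInner (M.mulVec v) w = reInner v (Mᴴ.mulVec w) := by
  simp [reInner, star_mulVec, dotProduct_mulVec]

end Norms

section Restriction

variable {N : ℕ}

lemma l2_restrictTo_sq (x : Fin N → ℂ) (T : Finset (Fin N)) :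
    l2 (restrictTo x T) ^ 2 = ∑ i ∈ T, ‖x i‖ ^ 2 := by
  rw [l2_sq, ← Finset.sum_subset (Finset.subset_univ T)]
  · exact Finset.sum_congr rfl fun i hi => by simp [restrictTo, hi]
  · intro i _ hi; simp [restrictTo, hi]

lemma l2_restrictTo_mono (x : Fin N → ℂ) {S T : Finset (Fin N)} (h : S ⊆ T) :
    l2 (restrictTo x S) ≤ l2 (restrictTo x T) := by
  refine (sq_le_sq₀ (l2_nonneg _) (l2_nonneg _)).1 ?_
  rw [l2_restrictTo_sq, l2_restrictTo_sq]
  exact Finset.sum_le_sum_of_subset_of_nonneg h fun _ _ _ => sq_nonneg _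

lemma l2_restrictTo_le (x : Fin N → ℂ) (T : Finset (Fin N)) : l2 (restrictTo x T) ≤ l2 x := by
  have h := l2_restrictTo_mono x (Finset.subset_univ T)
  rwa [show restrictTo x Finset.univ = x by ext; simp [restrictTo]] at h

lemma restrictTo_add_restrictTo_compl (x : Fin N → ℂ) (T : Finset (Fin N)) :
    restrictTo x T + restrictTo x Tᶜ = x := by
  ext i; by_cases h : i ∈ T <;> simp [restrictTo, h]

lemma reInner_restrictTo_self (x : Fin N → ℂ) (T : Finset (Fin N)) :
    reInner (restrictTo x T) x = l2 (restrictTo x T) ^ 2 := by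
  rw [← reInner_self]
  unfold reInner dotProduct
  congr 1
  refine Finset.sum_congr rfl fun i _ => ?_
  by_cases h : i ∈ T <;> simp [restrictTo, h]

lemma reInner_restrictTo_congr (x : Fin N → ℂ) {T : Finset (Fin N)} {y z : Fin N → ℂ}
    (h : ∀ i ∈ T, y i = z i) : reInner (restrictTo x T) y = reInner (restrictTo x T) z := by
  unfold reInner dotProduct
  congr 1
  refine Finset.sum_congr rfl fun i _ => ?_
  by_cases hi : i ∈ T
  · rw [h i hi]
  · simp [restrictTo, hi]

lemma restrictTo_apply_of_notMem (x : Fin N → ℂ) {T : Finset (Fin N)} {i : Fin N} (h : i ∉ T) :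
    restrictTo x T i = 0 := by simp [restrictTo, h]

lemma sparse_of_support {r : ℕ} {x : Fin N → ℂ} {T : Finset (Fin N)} (hT : T.card ≤ r)
    (hx : ∀ i ∉ T, x i = 0) : Sparse r x := by
  refine (Finset.card_le_card fun i hi => ?_).trans hT
  by_contra h
  simp [suppF, hx i h] at hi

lemma sum_le_sum_of_card_le_of_largest {f : Fin N → ℝ} (hf : ∀ i, 0 ≤ f i)
    {R T : Finset (Fin N)} (hc : R.card ≤ T.card) (hT : ∀ i ∈ T, ∀ j ∉ T, f j ≤ f i) :
    ∑ i ∈ R, f i ≤ ∑ i ∈ T, f i := by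
  have hc' : (R \ T).card ≤ (T \ R).card := by
    have h1 := Finset.card_sdiff_add_card_inter R T
    have h2 := Finset.card_sdiff_add_card_inter T R
    rw [Finset.inter_comm] at h2
    omega
  have key : ∑ i ∈ R \ T, f i ≤ ∑ i ∈ T \ R, f i := by
    obtain ⟨U, hU, hUc⟩ := Finset.exists_subset_card_eq hc'
    obtain ⟨g⟩ : Nonempty ({i // i ∈ R \ T} ≃ {i // i ∈ U}) :=
      ⟨Finset.equivOfCardEq hUc.symm⟩
    calc ∑ i ∈ R \ T, f i = ∑ i : {i // i ∈ R \ T}, f i := (Finset.sum_coe_sort _ _).symm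
      _ ≤ ∑ i : {i // i ∈ R \ T}, f (g i) := by
          refine Finset.sum_le_sum fun i _ => hT _ ?_ _ ?_
          · exact (Finset.mem_sdiff.1 (hU (g i).2)).1
          · exact (Finset.mem_sdiff.1 i.2).2
      _ = ∑ i : {i // i ∈ U}, f i := Equiv.sum_comp g fun i => f i
      _ = ∑ i ∈ U, f i := Finset.sum_coe_sort _ _
      _ ≤ ∑ i ∈ T \ R, f i := Finset.sum_le_sum_of_subset_of_nonneg hU fun _ _ _ => hf _
  have h1 := Finset.sum_inter_add_sum_sdiff R T f
  have h2 := Finset.sum_inter_add_sum_sdiff T R f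
  rw [Finset.inter_comm] at h2
  linarith

lemma exists_subset_card_eq_largest (f : Fin N → ℝ) (S : Finset (Fin N)) (n : ℕ)
    (hn : n ≤ S.card) :
    ∃ T ⊆ S, T.card = n ∧ ∀ i ∈ T, ∀ j ∈ S \ T, f j ≤ f i := by
  induction n with
  | zero => exact ⟨∅, by simp⟩
  | succ n ih =>
    obtain ⟨T, hTS, hTc, hT⟩ := ih (by omega)
    have hne : (S \ T).Nonempty := by
      rw [← Finset.card_pos, Finset.card_sdiff_of_subset hTS]; omega
    obtain ⟨k, hk, hmax⟩ := Finset.exists_max_image (S \ T) f hne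
    have hk' := Finset.mem_sdiff.1 hk
    refine ⟨insert k T, Finset.insert_subset hk'.1 hTS, ?_, ?_⟩
    · rw [Finset.card_insert_of_notMem hk'.2, hTc]
    · intro i hi j hj
      have hj' : j ∈ S \ T := by
        simp only [Finset.mem_sdiff, Finset.mem_insert, not_or] at hj ⊢
        exact ⟨hj.1, hj.2.2⟩
      rcases Finset.mem_insert.1 hi with rfl | hi
      · exact hmax j hj'
      · exact hT i hi j hj'

lemma IsSparseApprox.sparse {s : ℕ} {x y : Fin N → ℂ} (h : IsSparseApprox s x y) :
    Sparse s y := by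
  obtain ⟨T, hT, rfl, -⟩ := h
  exact sparse_of_support (T := T) (by omega) fun i hi => restrictTo_apply_of_notMem x hi

lemma IsSparseApprox.eq_restrictTo_suppF {s : ℕ} {x y : Fin N → ℂ} (h : IsSparseApprox s x y) :
    y = restrictTo x (suppF y) := by
  obtain ⟨T, hT, hy, -⟩ := h
  ext i
  by_cases hi : y i = 0
  · simp [restrictTo, suppF, hi]
  · have : i ∈ T := by
      by_contra hiT
      exact hi (by rw [hy, restrictTo_apply_of_notMem x hiT])
    have hyx : y i = x i := by rw [hy]; simp [restrictTo, this]
    simp [restrictTo, suppF, hyx]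

lemma IsSparseApprox.sum_le {s : ℕ} {x y : Fin N → ℂ} (h : IsSparseApprox s x y)
    {R : Finset (Fin N)} (hR : R.card ≤ s) : ∑ i ∈ R, ‖x i‖ ^ 2 ≤ l2 y ^ 2 := by
  obtain ⟨T, hT, rfl, hmax⟩ := h
  rw [l2_restrictTo_sq]
  refine sum_le_sum_of_card_le_of_largest (fun _ => sq_nonneg _) ?_
    fun i hi j hj => pow_le_pow_left₀ (norm_nonneg _) (hmax i hi j hj) 2
  have := R.card_le_univ
  rw [Fintype.card_fin] at this
  omega

/-- A best `s`-sparse approximation of `b` is within twice the distance from `b` to any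
`s`-sparse vector of that vector. -/
lemma IsSparseApprox.l2_sub_le {s : ℕ} {b b' x : Fin N → ℂ} (h : IsSparseApprox s b b')
    (hx : Sparse s x) : l2 (x - b') ≤ 2 * l2 (x - b) := by
  have hb : b' = restrictTo b (suppF b') := h.eq_restrictTo_suppF
  have h1 : l2 (b - b') ≤ l2 (b - x) := by
    refine (sq_le_sq₀ (l2_nonneg _) (l2_nonneg _)).1 ?_
    have e1 : b - b' = restrictTo b (suppF b')ᶜ := by
      nth_rw 1 [← restrictTo_add_restrictTo_compl b (suppF b'), ← hb]
      simp
    have e2 : restrictTo b (suppF x)ᶜ = restrictTo (b - x) (suppF x)ᶜ := by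
      ext i
      by_cases hi : x i = 0 <;> simp [restrictTo, suppF, hi]
    have h2 := h.sum_le hx
    have h3 := l2_restrictTo_le (b - x) (suppF x)ᶜ
    have h4 : l2 (restrictTo (b - x) (suppF x)ᶜ) ^ 2 ≤ l2 (b - x) ^ 2 :=
      pow_le_pow_left₀ (l2_nonneg _) h3 2
    rw [← e2, l2_restrictTo_sq] at h4
    rw [e1, l2_restrictTo_sq]
    rw [hb, l2_restrictTo_sq] at h2
    have h5 := Finset.sum_add_sum_compl (suppF b') fun i => ‖b i‖ ^ 2
    have h6 := Finset.sum_add_sum_compl (suppF x) fun i => ‖b i‖ ^ 2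
    linarith
  have h2 := l2_add_le (x - b) (b - b')
  rw [sub_add_sub_cancel] at h2
  rw [l2_sub_comm b x] at h1
  linarith

end Restriction

section RestrictedIsometry

variable {m N : ℕ}

/-- The restricted isometry property of order `r` with constant `δ`. -/
def HasRIP (Φ : Matrix (Fin m) (Fin N) ℂ) (r : ℕ) (δ : ℝ) : Prop :=
  ∀ x : Fin N → ℂ, Sparse r x →
    (1 - δ) * l2 x ^ 2 ≤ l2 (Φ.mulVec x) ^ 2 ∧ l2 (Φ.mulVec x) ^ 2 ≤ (1 + δ) * l2 x ^ 2

lemma exists_l2_mulVec_le (Φ : Matrix (Fin m) (Fin N) ℂ) :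
    ∃ C : ℝ, 0 ≤ C ∧ ∀ x, l2 (Φ.mulVec x) ≤ C * l2 x := by
  let L := (Matrix.toEuclideanLin Φ).toContinuousLinearMap
  refine ⟨‖L‖, norm_nonneg _, fun x => ?_⟩
  rw [l2_eq_norm, l2_eq_norm]
  exact L.le_opNorm (WithLp.toLp 2 x)

lemma HasRIP.of_RIC_le {Φ : Matrix (Fin m) (Fin N) ℂ} {r : ℕ} {δ : ℝ} (h : RIC Φ r ≤ δ) :
    HasRIP Φ r δ := by
  obtain ⟨C, hC0, hC⟩ := exists_l2_mulVec_le Φ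
  have hne : {δ : ℝ | 0 ≤ δ ∧ HasRIP Φ r δ}.Nonempty := by
    refine ⟨1 + C ^ 2, by positivity, fun x _ => ⟨?_, ?_⟩⟩
    · nlinarith [sq_nonneg (l2 (Φ.mulVec x)), mul_nonneg (sq_nonneg C) (sq_nonneg (l2 x))]
    · have := pow_le_pow_left₀ (l2_nonneg _) (hC x) 2
      nlinarith [sq_nonneg (l2 x)]
  intro x hx
  have key : ∀ ε > 0, (1 - (δ + ε)) * l2 x ^ 2 ≤ l2 (Φ.mulVec x) ^ 2 ∧
      l2 (Φ.mulVec x) ^ 2 ≤ (1 + (δ + ε)) * l2 x ^ 2 := by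
    intro ε hε
    obtain ⟨d, ⟨-, hd⟩, hdlt⟩ := exists_lt_of_csInf_lt hne
      (show sInf {δ : ℝ | 0 ≤ δ ∧ HasRIP Φ r δ} < δ + ε from lt_of_le_of_lt h (by linarith))
    have h1 := hd x hx
    have h2 := mul_le_mul_of_nonneg_right hdlt.le (sq_nonneg (l2 x))
    constructor <;> nlinarith [h1.1, h1.2]
  have hsq := sq_nonneg (l2 x)
  constructor
  · refine le_of_forall_pos_le_add fun ε hε => ?_
    have := (key (ε / (l2 x ^ 2 + 1)) (by positivity)).1
    have h3 : ε / (l2 x ^ 2 + 1) * l2 x ^ 2 ≤ ε := by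
      rw [div_mul_eq_mul_div, div_le_iff₀ (by positivity)]; nlinarith
    nlinarith
  · refine le_of_forall_pos_le_add fun ε hε => ?_
    have := (key (ε / (l2 x ^ 2 + 1)) (by positivity)).2
    have h3 : ε / (l2 x ^ 2 + 1) * l2 x ^ 2 ≤ ε := by
      rw [div_mul_eq_mul_div, div_le_iff₀ (by positivity)]; nlinarith
    nlinarith

variable {Φ : Matrix (Fin m) (Fin N) ℂ} {r : ℕ} {δ : ℝ}

lemma HasRIP.l2_mulVec_le (h : HasRIP Φ r δ) (hδ : δ ≤ 0.1) {x : Fin N → ℂ} (hx : Sparse r x) :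
    l2 (Φ.mulVec x) ≤ 1.05 * l2 x := by
  have := (h x hx).2
  refine (sq_le_sq₀ (l2_nonneg _) (by have := l2_nonneg x; positivity)).1 ?_
  nlinarith [sq_nonneg (l2 x)]

lemma HasRIP.reInner_sub_le (h : HasRIP Φ r δ) {S : Finset (Fin N)} (hS : S.card ≤ r)
    {x y : Fin N → ℂ} (hx : ∀ i ∉ S, x i = 0) (hy : ∀ i ∉ S, y i = 0) :
    reInner (Φ.mulVec x) (Φ.mulVec y) - reInner x y ≤ δ * l2 x * l2 y := by
  have key : ∀ x y : Fin N → ℂ, (∀ i ∉ S, x i = 0) → (∀ i ∉ S, y i = 0) →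
      2 * (reInner (Φ.mulVec x) (Φ.mulVec y) - reInner x y) ≤ δ * (l2 x ^ 2 + l2 y ^ 2) := by
    intro x y hx hy
    have h1 := (h (x + y) (sparse_of_support hS fun i hi => by simp [hx i hi, hy i hi])).2
    have h2 := (h (x - y) (sparse_of_support hS fun i hi => by simp [hx i hi, hy i hi])).1
    rw [mulVec_add, l2_add_sq, l2_add_sq] at h1
    rw [mulVec_sub, l2_sub_sq, l2_sub_sq] at h2
    linarith
  rcases (l2_nonneg x).eq_or_lt with h0 | hxpos
  · rw [eq_zero_of_l2_eq_zero h0.symm]; simp [reInner, l2_zero]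
  rcases (l2_nonneg y).eq_or_lt with h0 | hypos
  · rw [eq_zero_of_l2_eq_zero h0.symm]; simp [reInner, l2_zero]
  have h1 := key (l2 y • x) (l2 x • y) (fun i hi => by simp [hx i hi])
    fun i hi => by simp [hy i hi]
  rw [mulVec_smul, mulVec_smul, reInner_smul_smul, reInner_smul_smul, l2_smul, l2_smul,
    abs_of_pos hxpos, abs_of_pos hypos] at h1
  refine le_of_mul_le_mul_left ?_ (mul_pos hypos hxpos)
  linarith

/-- Splitting off a block of `s` largest entries: the remaining entries are bounded by the average
of the block. -/
lemma exists_block {s : ℕ} (hs : 0 < s) (S : Finset (Fin N)) (w : Fin N → ℂ)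
    (hw : ∀ i ∉ S, w i = 0) :
    ∃ T ⊆ S, T.card ≤ s ∧ (S.Nonempty → T.Nonempty) ∧ ∃ M : ℝ, 0 ≤ M ∧
      (∀ i, ‖restrictTo w Tᶜ i‖ ≤ M) ∧
      Real.sqrt s * M + (Real.sqrt s)⁻¹ * l1 (restrictTo w Tᶜ) ≤ (Real.sqrt s)⁻¹ * l1 w := by
  rcases le_or_gt S.card s with hS | hS
  · have h0 : restrictTo w Sᶜ = 0 := by
      ext i; by_cases hi : i ∈ S <;> simp [restrictTo, hi, hw]
    refine ⟨S, subset_rfl, hS, id, 0, le_rfl, fun i => by simp [h0], ?_⟩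
    rw [h0]
    have : 0 ≤ l1 w := Finset.sum_nonneg fun _ _ => norm_nonneg _
    simp only [l1, Pi.zero_apply, norm_zero, Finset.sum_const_zero, mul_zero, add_zero]
    exact mul_nonneg (by positivity) this
  · obtain ⟨T, hTS, hTc, hT⟩ := exists_subset_card_eq_largest (fun i => ‖w i‖) S s hS.le
    have hTne : T.Nonempty := Finset.card_pos.1 (by omega)
    obtain ⟨k, hk, hmin⟩ := Finset.exists_min_image T (fun i => ‖w i‖) hTne
    refine ⟨T, hTS, hTc.le, fun _ => hTne, ‖w k‖, norm_nonneg _, fun i => ?_, ?_⟩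
    · by_cases hiT : i ∈ T
      · simp [restrictTo, hiT]
      · by_cases hiS : i ∈ S
        · simpa [restrictTo, hiT] using hT k hk i (Finset.mem_sdiff.2 ⟨hiS, hiT⟩)
        · simp [restrictTo, hw i hiS]
    · have h1 : (s : ℝ) * ‖w k‖ ≤ ∑ i ∈ T, ‖w i‖ := by
        have := Finset.card_nsmul_le_sum T (fun i => ‖w i‖) _ hmin
        rwa [hTc, nsmul_eq_mul] at this
      have h2 : l1 w = ∑ i ∈ T, ‖w i‖ + l1 (restrictTo w Tᶜ) := by
        rw [l1, l1, ← Finset.sum_add_sum_compl T]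
        congr 1
        rw [← Finset.sum_subset (Finset.subset_univ Tᶜ)]
        · exact Finset.sum_congr rfl fun i hi => by simp [restrictTo, Finset.mem_compl.1 hi]
        · intro i _ hi; simp [restrictTo_apply_of_notMem w hi]
      have hpos : 0 < Real.sqrt s := Real.sqrt_pos.2 (by exact_mod_cast hs)
      have h3 : Real.sqrt s * ‖w k‖ = (Real.sqrt s)⁻¹ * (s * ‖w k‖) := by
        field_simp
        rw [Real.sq_sqrt (Nat.cast_nonneg s), mul_comm]
      rw [h2, h3, mul_add]
      gcongr

lemma HasRIP.energy_bound_of_forall_le (h : HasRIP Φ r δ) (hδ : δ ≤ 0.1) {s : ℕ} (hs : 0 < s)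
    (hsr : s ≤ r) (n : ℕ) : ∀ (S : Finset (Fin N)) (w : Fin N → ℂ) (M : ℝ), S.card ≤ n → 0 ≤ M →
      (∀ i ∉ S, w i = 0) → (∀ i, ‖w i‖ ≤ M) →
      l2 (Φ.mulVec w) ≤ 1.05 * (Real.sqrt s * M + (Real.sqrt s)⁻¹ * l1 w) := by
  induction n with
  | zero =>
    intro S w M hS hM hw _
    have hS' : S = ∅ := Finset.card_eq_zero.1 (by omega)
    have hw0 : w = 0 := funext fun i => hw i (by simp [hS'])
    rw [hw0, mulVec_zero, l2_zero]
    simp only [l1, Pi.zero_apply, norm_zero, Finset.sum_const_zero, mul_zero, add_zero]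
    positivity
  | succ n ih =>
    intro S w M hS hM hw hwM
    obtain ⟨T, hTS, hTc, hTne, M', hM', hwM', hsum⟩ := exists_block hs S w hw
    have hcard : (S \ T).card ≤ n := by
      rcases S.eq_empty_or_nonempty with rfl | hne
      · simp
      · have := Finset.card_pos.2 (hTne hne)
        rw [Finset.card_sdiff_of_subset hTS]
        omega
    have h1 := ih (S \ T) (restrictTo w Tᶜ) M' hcard hM'
      (fun i hi => by
        by_cases hiT : i ∈ T
        · simp [restrictTo, hiT]
        · have : i ∉ S := fun hiS => hi (Finset.mem_sdiff.2 ⟨hiS, hiT⟩)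
          simp [restrictTo, hw i this]) hwM'
    have h2 := h.l2_mulVec_le hδ (sparse_of_support (hTc.trans hsr)
      fun i => restrictTo_apply_of_notMem w (i := i))
    have h3 : l2 (restrictTo w T) ≤ Real.sqrt s * M := by
      refine (sq_le_sq₀ (l2_nonneg _) (by positivity)).1 ?_
      rw [l2_restrictTo_sq, mul_pow, Real.sq_sqrt (Nat.cast_nonneg s)]
      calc ∑ i ∈ T, ‖w i‖ ^ 2 ≤ T.card • M ^ 2 :=
            Finset.sum_le_card_nsmul _ _ _ fun i _ => pow_le_pow_left₀ (norm_nonneg _) (hwM i) 2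
        _ ≤ s * M ^ 2 := by rw [nsmul_eq_mul]; gcongr
    have h4 := l2_add_le (Φ.mulVec (restrictTo w T)) (Φ.mulVec (restrictTo w Tᶜ))
    rw [← mulVec_add, restrictTo_add_restrictTo_compl] at h4
    linarith

/-- The energy bound: samples of an arbitrary vector are controlled by a mixed norm. -/
lemma HasRIP.energy_bound (h : HasRIP Φ r δ) (hδ : δ ≤ 0.1) {s : ℕ} (hs : 0 < s)
    (hsr : s ≤ r) (w : Fin N → ℂ) :
    l2 (Φ.mulVec w) ≤ 1.05 * (l2 w + (Real.sqrt s)⁻¹ * l1 w) := by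
  obtain ⟨T, -, hTc, -, M, hM, hwM, hsum⟩ := exists_block hs Finset.univ w (by simp)
  have h1 := h.energy_bound_of_forall_le hδ hs hsr N Finset.univ (restrictTo w Tᶜ) M (by simp) hM
    (by simp) hwM
  have h2 := h.l2_mulVec_le hδ (sparse_of_support (hTc.trans hsr)
    fun i => restrictTo_apply_of_notMem w (i := i))
  have h3 := l2_restrictTo_le w T
  have h4 := l2_add_le (Φ.mulVec (restrictTo w T)) (Φ.mulVec (restrictTo w Tᶜ))
  rw [← mulVec_add, restrictTo_add_restrictTo_compl] at h4
  linarith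

lemma mulVec_extend (T : Finset (Fin N)) (c : {i // i ∈ T} → ℂ) :
    Φ.mulVec (fun j => if h : j ∈ T then c ⟨j, h⟩ else 0) = (colSub Φ T).mulVec c := by
  ext i
  simp only [mulVec, dotProduct, colSub, Matrix.of_apply]
  rw [← Finset.sum_subset (Finset.subset_univ T), ← Finset.sum_coe_sort]
  · exact Finset.sum_congr rfl fun j _ => by simp
  · intro j _ hj; simp [hj]

/-- The least-squares estimate satisfies the normal equations. -/
lemma HasRIP.normal_equations (h : HasRIP Φ r δ) (hδ : δ ≤ 0.1) {T : Finset (Fin N)}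
    (hT : T.card ≤ r) (u : Fin m → ℂ) :
    ∀ j ∈ T, Φᴴ.mulVec (Φ.mulVec (pinvApply Φ T u)) j = Φᴴ.mulVec u j := by
  set A := colSub Φ T with hA
  have hinj : Function.Injective (Aᴴ * A).mulVec := by
    rw [← Matrix.coe_mulVecLin, ← LinearMap.ker_eq_bot, LinearMap.ker_eq_bot']
    intro c hc
    replace hc : A.mulVec c = 0 := by
      refine eq_zero_of_l2_eq_zero ((pow_eq_zero_iff two_ne_zero).1 ?_)
      rw [mulVecLin_apply, ← mulVec_mulVec] at hc
      rw [← reInner_self, reInner_mulVec, hc]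
      simp [reInner]
    rw [hA, ← mulVec_extend] at hc
    set c' : Fin N → ℂ := fun j => if h : j ∈ T then c ⟨j, h⟩ else 0 with hc'
    have h1 := (h c' (sparse_of_support hT fun i hi => by simp [hc', hi])).1
    rw [hc, l2_zero] at h1
    have h2 : l2 c' = 0 := by
      refine pow_eq_zero_iff (two_ne_zero) |>.1 ?_
      nlinarith [sq_nonneg (l2 c')]
    have h3 := eq_zero_of_l2_eq_zero h2
    ext ⟨j, hj⟩
    have := congrFun h3 j
    simpa [hc', hj] using this
  have hdet : IsUnit (Aᴴ * A).det :=
    (Matrix.isUnit_iff_isUnit_det _).1 (Matrix.mulVec_injective_iff_isUnit.1 hinj)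
  intro j hj
  have hb : Φ.mulVec (pinvApply Φ T u) = A.mulVec (((Aᴴ * A)⁻¹ * Aᴴ).mulVec u) := by
    rw [hA, ← mulVec_extend]; rfl
  have hn : Aᴴ.mulVec (A.mulVec (((Aᴴ * A)⁻¹ * Aᴴ).mulVec u)) = Aᴴ.mulVec u := by
    rw [mulVec_mulVec, mulVec_mulVec, ← Matrix.mul_assoc, Matrix.mul_nonsing_inv _ hdet,
      Matrix.one_mul]
  rw [hb]
  exact congrFun hn ⟨j, hj⟩

end RestrictedIsometry

section Iteration

variable {m N : ℕ} {Φ : Matrix (Fin m) (Fin N) ℂ} {s : ℕ} {δ : ℝ}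

/-- The signal proxy locates most of the energy of a `2s`-sparse vector. -/
lemma HasRIP.identification (h : HasRIP Φ (4 * s) δ) (hδ : δ ≤ 0.1) {v y : Fin N → ℂ}
    (hv : Sparse (2 * s) v) (e : Fin m → ℂ)
    (hy : IsSparseApprox (2 * s) (Φᴴ.mulVec (Φ.mulVec v + e)) y) :
    l2 (restrictTo v (suppF y)ᶜ) ≤ 0.2 * l2 v + 2.1 * l2 e := by
  set p := Φᴴ.mulVec (Φ.mulVec v + e) with hp
  set R := suppF v with hR
  set Ω := suppF y with hΩ
  have hvR : ∀ i ∉ R, v i = 0 := fun i hi => by simpa [hR, suppF] using hi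
  have hcard : (R ∪ Ω).card ≤ 4 * s := by
    have h1 : R.card ≤ 2 * s := hv
    have h2 : Ω.card ≤ 2 * s := hy.sparse
    have := Finset.card_union_le R Ω
    omega
  set z := p - v with hz
  set zS := restrictTo z (R ∪ Ω) with hzS
  have hz0 : ∀ i ∉ R ∪ Ω, zS i = 0 := fun i hi => restrictTo_apply_of_notMem z hi
  have hz_le : l2 zS ≤ 0.1 * l2 v + 1.05 * l2 e := by
    have h1 : l2 zS ^ 2 = reInner (Φ.mulVec zS) (Φ.mulVec v) - reInner zS v
        + reInner (Φ.mulVec zS) e := by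
      rw [hzS, ← reInner_restrictTo_self, ← hzS, hz, hp, reInner_sub_right, ← reInner_mulVec,
        reInner_add_right]
      ring
    have h2 := h.reInner_sub_le hcard hz0 fun i hi => hvR i fun hi' =>
      hi (Finset.mem_union_left _ hi')
    have h3 := reInner_le (Φ.mulVec zS) e
    have h4 := h.l2_mulVec_le hδ (sparse_of_support hcard hz0)
    have h5 := mul_le_mul_of_nonneg_right h4 (l2_nonneg e)
    have h6 := mul_le_mul_of_nonneg_right hδ (mul_nonneg (l2_nonneg zS) (l2_nonneg v))
    rcases (l2_nonneg zS).eq_or_lt with h0 | hpos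
    · rw [← h0]
      have := l2_nonneg v
      have := l2_nonneg e
      positivity
    · refine le_of_mul_le_mul_left ?_ hpos
      linarith
  have hp_le : l2 (restrictTo p (R \ Ω)) ≤ l2 (restrictTo p (Ω \ R)) := by
    refine (sq_le_sq₀ (l2_nonneg _) (l2_nonneg _)).1 ?_
    have h1 := hy.sum_le hv
    rw [hy.eq_restrictTo_suppF, l2_restrictTo_sq] at h1
    rw [l2_restrictTo_sq, l2_restrictTo_sq]
    have h2 := Finset.sum_inter_add_sum_sdiff R Ω fun i => ‖p i‖ ^ 2
    have h3 := Finset.sum_inter_add_sum_sdiff Ω R fun i => ‖p i‖ ^ 2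
    rw [Finset.inter_comm] at h3
    linarith
  have e1 : restrictTo v Ωᶜ = restrictTo p (R \ Ω) - restrictTo z (R \ Ω) := by
    ext i
    by_cases hiR : i ∈ R <;> by_cases hiΩ : i ∈ Ω <;> simp [restrictTo, hiR, hiΩ, hz, hvR]
  have e2 : restrictTo p (Ω \ R) = restrictTo z (Ω \ R) := by
    ext i
    by_cases hiR : i ∈ R <;> by_cases hiΩ : i ∈ Ω <;> simp [restrictTo, hiR, hiΩ, hz, hvR]
  have h1 := l2_sub_le (restrictTo p (R \ Ω)) (restrictTo z (R \ Ω))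
  have h2 : l2 (restrictTo z (R \ Ω)) ≤ l2 zS := l2_restrictTo_mono z (by grind)
  have h3 : l2 (restrictTo z (Ω \ R)) ≤ l2 zS := l2_restrictTo_mono z (by grind)
  rw [e1]
  rw [e2] at hp_le
  linarith

/-- Accuracy of the least-squares estimate of a sparse vector. -/
lemma HasRIP.estimation (h : HasRIP Φ (4 * s) δ) (hδ : δ ≤ 0.1) {x : Fin N → ℂ}
    (hx : Sparse s x) (e : Fin m → ℂ) {T : Finset (Fin N)} (hT : T.card ≤ 3 * s) :
    0.9 * l2 (x - pinvApply Φ T (Φ.mulVec x + e)) ≤ l2 (restrictTo x Tᶜ) + 1.05 * l2 e := by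
  set b := pinvApply Φ T (Φ.mulVec x + e) with hb
  have hbT : ∀ i ∉ T, b i = 0 := fun i hi => by simp [hb, pinvApply, hi]
  have hxR : ∀ i ∉ suppF x, x i = 0 := fun i hi => by simpa [suppF] using hi
  have hcard : (T ∪ suppF x).card ≤ 4 * s := by
    have h1 : (suppF x).card ≤ s := hx
    have := Finset.card_union_le T (suppF x)
    omega
  rw [l2_sub_comm]
  set d := b - x with hd
  set dT := restrictTo d T with hdT
  have hd0 : ∀ i ∉ T ∪ suppF x, d i = 0 := fun i hi => by
    rw [Finset.mem_union, not_or] at hi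
    simp [hd, hbT i hi.1, hxR i hi.2]
  have hdT0 : ∀ i ∉ T ∪ suppF x, dT i = 0 := fun i hi =>
    restrictTo_apply_of_notMem d fun hi' => hi (Finset.mem_union_left _ hi')
  have hne : reInner (Φ.mulVec dT) (Φ.mulVec d) = reInner (Φ.mulVec dT) e := by
    rw [reInner_mulVec, reInner_mulVec]
    refine reInner_restrictTo_congr d fun j hj => ?_
    have := h.normal_equations hδ (hT.trans (by omega)) (Φ.mulVec x + e) j hj
    rw [← hb, mulVec_add, Pi.add_apply] at this
    rw [hd, mulVec_sub, mulVec_sub, Pi.sub_apply, this]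
    ring
  have hdT_le : l2 dT ≤ 0.1 * l2 d + 1.05 * l2 e := by
    have h1 := h.reInner_sub_le (y := -d) hcard hdT0 fun i hi => by simp [hd0 i hi]
    rw [mulVec_neg, reInner_neg_right, reInner_neg_right, l2_neg, hne] at h1
    have h2 : reInner dT d = l2 dT ^ 2 := reInner_restrictTo_self d T
    have h3 := reInner_le (Φ.mulVec dT) e
    have h4 := h.l2_mulVec_le hδ (sparse_of_support hcard hdT0)
    have h5 := mul_le_mul_of_nonneg_right h4 (l2_nonneg e)
    have h6 := mul_le_mul_of_nonneg_right hδ (mul_nonneg (l2_nonneg dT) (l2_nonneg d))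
    rcases (l2_nonneg dT).eq_or_lt with h0 | hpos
    · rw [← h0]
      have := l2_nonneg d
      have := l2_nonneg e
      positivity
    · refine le_of_mul_le_mul_left ?_ hpos
      linarith
  have h1 := l2_add_le dT (restrictTo d Tᶜ)
  rw [hdT, restrictTo_add_restrictTo_compl] at h1
  have h2 : l2 (restrictTo d Tᶜ) = l2 (restrictTo x Tᶜ) := by
    rw [l2, l2]
    congr 1
    refine Finset.sum_congr rfl fun i _ => ?_
    by_cases hi : i ∈ T <;> simp [restrictTo, hi, hd, hbT]
  linarith

/-- One CoSaMP iteration on an exactly sparse signal with noisy samples. -/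
lemma CoSaMPStep.l2_sub_le (h : HasRIP Φ (4 * s) δ) (hδ : δ ≤ 0.1) {x a a' : Fin N → ℂ}
    (hx : Sparse s x) (ha : Sparse s a) (e : Fin m → ℂ)
    (hstep : CoSaMPStep Φ (Φ.mulVec x + e) s a a') :
    l2 (x - a') ≤ 0.5 * l2 (x - a) + 7.5 * l2 e := by
  obtain ⟨y, hy, hb⟩ := hstep
  have hv : Sparse (2 * s) (x - a) := by
    refine sparse_of_support (T := suppF x ∪ suppF a) ?_ fun i hi => ?_
    · have h1 : (suppF x).card ≤ s := hx
      have h2 : (suppF a).card ≤ s := ha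
      have := Finset.card_union_le (suppF x) (suppF a)
      omega
    · simp only [suppF, Finset.mem_union, Finset.mem_filter, Finset.mem_univ, true_and, not_or,
        not_not] at hi
      simp [hi.1, hi.2]
  rw [show Φ.mulVec x + e - Φ.mulVec a = Φ.mulVec (x - a) + e by rw [mulVec_sub]; abel] at hy
  have hcard : (suppF y ∪ suppF a).card ≤ 3 * s := by
    have h1 : (suppF y).card ≤ 2 * s := hy.sparse
    have h2 : (suppF a).card ≤ s := ha
    have := Finset.card_union_le (suppF y) (suppF a)
    omega
  have h1 := h.identification hδ hv e hy
  have h2 := h.estimation hδ hx e hcard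
  have h3 := hb.l2_sub_le hx
  have h4 : restrictTo x (suppF y ∪ suppF a)ᶜ = restrictTo (x - a) (suppF y ∪ suppF a)ᶜ := by
    ext i
    by_cases hi : a i = 0 <;> simp [restrictTo, suppF, hi]
  have h5 : l2 (restrictTo (x - a) (suppF y ∪ suppF a)ᶜ) ≤ l2 (restrictTo (x - a) (suppF y)ᶜ) :=
    l2_restrictTo_mono _ (Finset.compl_subset_compl.2 Finset.subset_union_left)
  rw [h4] at h2
  linarith [l2_nonneg (x - a), l2_nonneg e]

end Iteration

/-- **CoSaMP iteration invariant (general signals).**  If `Φ` has restricted isometry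
constant `δ_{4s} ≤ 0.1` and `u = Φx + e`, then every CoSaMP approximation `a^k` is
`s`-sparse and `‖x − a^{k+1}‖₂ ≤ 0.5‖x − a^k‖₂ + 10ν`, where
`ν = ‖x − x_s‖₂ + s^{-1/2}‖x − x_s‖₁ + ‖e‖₂` is the unrecoverable energy. -/
theorem cosamp_iteration_invariant
    {m N : ℕ} (s : ℕ) (hs : 0 < s)
    (Φ : Matrix (Fin m) (Fin N) ℂ) (hΦ : RIC Φ (4 * s) ≤ 0.1)
    (x : Fin N → ℂ) (e : Fin m → ℂ) (u : Fin m → ℂ) (hu : u = Φ.mulVec x + e)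
    (a : ℕ → Fin N → ℂ) (ha : CoSaMPSeq Φ u s a)
    (xs : Fin N → ℂ) (hxs : IsSparseApprox s x xs) :
    ∀ k : ℕ, Sparse s (a k) ∧
      l2 (x - a (k + 1)) ≤
        0.5 * l2 (x - a k) +
          10 * (l2 (x - xs) + (Real.sqrt s)⁻¹ * l1 (x - xs) + l2 e) := by
  have hrip := HasRIP.of_RIC_le hΦ
  have hsparse : ∀ k, Sparse s (a k) := by
    intro k
    cases k with
    | zero => rw [ha.1]; simp [Sparse, suppF]
    | succ k =>
      obtain ⟨y, -, hb⟩ := ha.2 k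
      exact hb.sparse
  intro k
  refine ⟨hsparse k, ?_⟩
  have hu' : u = Φ.mulVec xs + (Φ.mulVec (x - xs) + e) := by
    rw [hu, mulVec_sub]; abel
  have hstep := ha.2 k
  rw [hu'] at hstep
  have h1 := hstep.l2_sub_le hrip le_rfl hxs.sparse (hsparse k)
  have h2 := l2_add_le (Φ.mulVec (x - xs)) e
  have h3 := hrip.energy_bound le_rfl hs (by omega) (x - xs)
  have h4 := l2_add_le (x - xs) (xs - a (k + 1))
  have h5 := l2_add_le (xs - x) (x - a k)
  rw [sub_add_sub_cancel] at h4 h5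
  rw [l2_sub_comm xs x] at h5
  have h6 : 0 ≤ (Real.sqrt s)⁻¹ * l1 (x - xs) :=
    mul_nonneg (by positivity) (Finset.sum_nonneg fun _ _ => norm_nonneg _)
  linarith [l2_nonneg (x - xs), l2_nonneg e]
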